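/- arXiv:0807.3088 — 2 statements merged into one kernel-verified Lean document; each statement's English description precedes it below -/
import Mathlib

section
/- Let K be a linearly ordered idempotent semifield and A : Matrix (Fin n) (Fin n) K. Then A is *singular (singular in the sense of Gondran–Minoux) if and only if det₊(A) = det₋(A). -/
/-- A matrix is *singular if there are vectors `x₁, x₂` with disjoint supports,
not both zero, such that `A x₁ = A x₂`. -/
def Matrix.TropStarSingular {K : Type*} [Semifield K] {m n : Type*} [Fintype n]
    (A : Matrix m n K) : Prop :=
  ∃ x₁ x₂ : n → K, (∀ k, x₁ k = 0 ∨ x₂ k = 0) ∧ x₁ + x₂ ≠ 0 ∧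
    A.mulVec x₁ = A.mulVec x₂

open Function in
theorem Function.periodicPts_nonempty_of_finite {ι : Type*} [Finite ι] [Nonempty ι] (f : ι → ι) :
    (periodicPts f).Nonempty := by
  obtain ⟨x⟩ := ‹Nonempty ι›
  obtain ⟨k, l, hkl, h⟩ := Finite.exists_ne_map_eq_of_infinite fun k : ℕ => f^[k] x
  wlog hlt : k < l generalizing k l
  · exact this l k hkl.symm h.symm (by omega)
  refine ⟨f^[k] x, mk_mem_periodicPts (n := l - k) (by omega) ?_⟩
  change f^[l - k] (f^[k] x) = f^[k] x
  rw [← iterate_add_apply, Nat.sub_add_cancel hlt.le]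
  exact h.symm

/-- A cyclic permutation that alternates between two classes is odd. -/
theorem Equiv.Perm.IsCycle.sign_eq_neg_one_of_alternating {ι : Type*} [Fintype ι] [DecidableEq ι]
    {c : Equiv.Perm ι} (hc : c.IsCycle) (p : ι → Prop)
    (hp : ∀ x, c x ≠ x → (p (c x) ↔ ¬ p x)) : Equiv.Perm.sign c = -1 := by
  obtain ⟨x, hx, -⟩ := id hc
  have key : ∀ k : ℕ, p ((c ^ k) x) ↔ (Even k ↔ p x) := by
    intro k
    induction k with
    | zero => simp
    | succ k ih =>
      have hk : c ((c ^ k) x) ≠ (c ^ k) x := by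
        simpa [← Equiv.Perm.mem_support] using hx
      rw [pow_succ', Equiv.Perm.mul_apply, hp _ hk, ih, Nat.even_add_one]
      tauto
  have he : Even c.support.card := by
    have h := key (orderOf c)
    rw [pow_orderOf_eq_one, hc.orderOf] at h
    simp only [Equiv.Perm.one_apply] at h
    tauto
  rw [hc.sign, he.neg_one_pow]

/-- A self-map of a finite nonempty type that alternates between two classes contains an odd
cycle, in the sense of parity of permutations. -/
theorem exists_odd_perm_of_alternating {ι : Type*} [Fintype ι] [DecidableEq ι] [Nonempty ι]
    (f : ι → ι) (p : ι → Prop) (hp : ∀ x, p (f x) ↔ ¬ p x) :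
    ∃ c : Equiv.Perm ι, Equiv.Perm.sign c = -1 ∧ ∀ x, c x = x ∨ c x = f x := by
  classical
  obtain ⟨x, hx⟩ := Function.periodicPts_nonempty_of_finite f
  let e : Equiv.Perm (Function.periodicPts f) := (Function.bijOn_periodicPts f).equiv f
  let g : Equiv.Perm ι := Equiv.Perm.ofSubtype (p := (· ∈ Function.periodicPts f)) e
  have hgf : ∀ y ∈ Function.periodicPts f, g y = f y := fun y hy =>
    Equiv.Perm.ofSubtype_apply_of_mem e hy
  have hg : ∀ y, g y = y ∨ g y = f y := by
    intro y
    by_cases hy : y ∈ Function.periodicPts f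
    · exact Or.inr (hgf y hy)
    · exact Or.inl (Equiv.Perm.ofSubtype_apply_of_not_mem e hy)
  have hcg : ∀ y, g.cycleOf x y = y ∨ g.cycleOf x y = f y := by
    intro y
    rw [Equiv.Perm.cycleOf_apply]
    split_ifs
    · exact hg y
    · exact Or.inl rfl
  have hgx : g x ≠ x := by
    intro h
    have := hp x
    rw [← hgf x hx, h] at this
    tauto
  refine ⟨g.cycleOf x, (g.isCycle_cycleOf hgx).sign_eq_neg_one_of_alternating p ?_, hcg⟩
  intro y hy
  rw [(hcg y).resolve_left hy]
  exact hp y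

/-- An odd permutation has a cycle whose support can be coloured alternatingly. -/
theorem Equiv.Perm.exists_alternating_of_sign_eq_neg_one {ι : Type*} [Fintype ι] [DecidableEq ι]
    (ρ : Equiv.Perm ι) (hρ : Equiv.Perm.sign ρ = -1) :
    ∃ (s : Set ι) (p : ι → Prop), s.Nonempty ∧
      ∀ x ∈ s, ρ x ∈ s ∧ (p (ρ x) ↔ ¬ p x) := by
  have hcyc : Equiv.Perm.sign ρ = -1 →
      ∃ c : Equiv.Perm ι, c.IsCycle ∧ Equiv.Perm.sign c = -1 ∧ ∀ x, c x ≠ x → ρ x = c x := by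
    clear hρ
    induction ρ using Equiv.Perm.cycle_induction_on with
    | base_one => intro h; simp at h
    | base_cycles σ hσ => exact fun h => ⟨σ, hσ, h, fun _ _ => rfl⟩
    | induction_disjoint σ τ hd hσ h1 h2 =>
      intro h
      rw [Equiv.Perm.sign_mul] at h
      rcases Int.units_eq_one_or (Equiv.Perm.sign σ) with hs | hs
      · obtain ⟨c, hc, hcs, hcτ⟩ := h2 (by simpa [hs] using h)
        refine ⟨c, hc, hcs, fun x hx => ?_⟩
        have hcx : c (c x) ≠ c x := fun h => hx (c.injective h)
        rw [Equiv.Perm.mul_apply, hcτ x hx]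
        exact (hd (c x)).resolve_right (by rwa [hcτ _ hcx])
      · refine ⟨σ, hσ, hs, fun x hx => ?_⟩
        rw [Equiv.Perm.mul_apply, (hd x).resolve_left hx]
  obtain ⟨c, hc, hsign, hcρ⟩ := hcyc hρ
  obtain ⟨x, hx, -⟩ := id hc
  have hodd : ∀ k : ℕ, Odd k → (c ^ k) x ≠ x := by
    intro k hk h
    have h1 : c ^ k = 1 := hc.pow_eq_one_iff.2 ⟨x, hx, h⟩
    have h2 := congrArg Equiv.Perm.sign h1
    rw [map_pow, hsign, hk.neg_one_pow, map_one] at h2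
    exact absurd h2 (by decide)
  refine ⟨{y | c y ≠ y}, fun y => ∃ k : ℕ, y = (c ^ (2 * k)) x, ⟨x, hx⟩, ?_⟩
  intro y hy
  rw [hcρ y hy]
  refine ⟨fun h => hy (c.injective h), ?_⟩
  constructor
  · rintro ⟨k, hk⟩ ⟨l, rfl⟩
    rw [← Equiv.Perm.mul_apply, ← pow_succ'] at hk
    rcases le_total (2 * l + 1) (2 * k) with h | h
    · refine hodd (2 * k - (2 * l + 1)) ⟨k - l - 1, by omega⟩ ?_
      apply (c ^ (2 * l + 1)).injective
      rw [← Equiv.Perm.mul_apply, ← pow_add, Nat.add_sub_cancel' h, hk]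
    · refine hodd (2 * l + 1 - 2 * k) ⟨l - k, by omega⟩ ?_
      apply (c ^ (2 * k)).injective
      rw [← Equiv.Perm.mul_apply, ← pow_add, Nat.add_sub_cancel' h, hk]
  · intro hny
    obtain ⟨k, rfl⟩ := hc.exists_pow_eq hx hy
    rcases Nat.even_or_odd' k with ⟨l, rfl | rfl⟩
    · exact absurd ⟨l, rfl⟩ hny
    · exact ⟨l + 1, by rw [← Equiv.Perm.mul_apply, ← pow_succ']; rfl⟩

/-- The weight of a path in the complete digraph with edge weights `B`. -/
def Matrix.pathWeight {K ι : Type*} [CommSemiring K] (B : Matrix ι ι K) : List ι → K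
  | [] => 1
  | [_] => 1
  | a :: b :: l => B a b * Matrix.pathWeight B (b :: l)

theorem Matrix.pathWeight_append_cons {K ι : Type*} [CommSemiring K] (B : Matrix ι ι K)
    (s : List ι) (k : ι) (t : List ι) :
    B.pathWeight (s ++ k :: t) = B.pathWeight (s ++ [k]) * B.pathWeight (k :: t) := by
  induction s with
  | nil => simp [pathWeight]
  | cons a s ih =>
    cases s with
    | nil => simp [pathWeight]
    | cons b s =>
      simp only [List.cons_append, pathWeight] at ih ⊢
      rw [ih, mul_assoc]

/-- If `B` has unit diagonal, the weight of a simple path ending at `e` is the weight, with the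
factor at `e` left out, of the permutation that closes the path into a cycle. -/
theorem Matrix.exists_perm_pathWeight_mul {K ι : Type*} [CommSemiring K] [Fintype ι]
    [DecidableEq ι] (B : Matrix ι ι K) (hdiag : ∀ i, B i i = 1) (s : List ι) (e : ι)
    (hs : (s ++ [e]).Nodup) :
    ∃ τ : Equiv.Perm ι, (∀ x ∉ s ++ [e], τ x = x) ∧ (s ++ [e]).head? = some (τ e) ∧
      ∏ x ∈ Finset.univ.erase e, B x (τ x) = B.pathWeight (s ++ [e]) := by
  induction s with
  | nil => exact ⟨1, by simp, by simp, by simp [pathWeight, hdiag]⟩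
  | cons a s ih =>
    rw [List.cons_append, List.nodup_cons] at hs
    obtain ⟨ha, hs⟩ := hs
    obtain ⟨τ, hfix, hhead, hprod⟩ := ih hs
    obtain ⟨l, hl⟩ : ∃ l, s ++ [e] = τ e :: l := by
      cases h : s ++ [e] with
      | nil => simp at h
      | cons b l => rw [h] at hhead; simp at hhead; exact ⟨l, by rw [hhead]⟩
    have hτa : τ a = a := hfix a ha
    have hae : a ≠ e := by rintro rfl; simp at ha
    refine ⟨Equiv.swap a (τ e) * τ, ?_, ?_, ?_⟩
    · intro x hx
      simp only [List.cons_append, List.mem_cons, not_or] at hx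
      rw [Equiv.Perm.mul_apply, hfix x hx.2, Equiv.swap_apply_of_ne_of_ne hx.1]
      rintro rfl
      exact hx.2 (by simp [hl])
    · simp
    · have hmem : a ∈ Finset.univ.erase e := by simp [hae]
      rw [List.cons_append, hl, pathWeight, ← hl, ← hprod, ← Finset.mul_prod_erase _ _ hmem,
        ← Finset.mul_prod_erase _ (fun x => B x (τ x)) hmem, hτa, hdiag, one_mul]
      congr 1
      · simp [hτa]
      · refine Finset.prod_congr rfl fun x hx => ?_
        simp only [Finset.mem_erase, Finset.mem_univ, and_true] at hx
        rw [Equiv.Perm.mul_apply, Equiv.swap_apply_of_ne_of_ne]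
        · rw [← hτa]; exact fun h => hx.1 (τ.injective h)
        · exact fun h => hx.2 (τ.injective h)

section Ordered

variable {K : Type*} [Semifield K] [LinearOrder K]

theorem Finset.sum_le_iff_of_add_eq_max [CanonicallyOrderedAdd K]
    (hadd : ∀ a b : K, a + b = max a b) {ι : Type*} (s : Finset ι) (f : ι → K) (c : K) :
    ∑ i ∈ s, f i ≤ c ↔ ∀ i ∈ s, f i ≤ c := by
  classical
  induction s using Finset.induction_on with
  | empty => simp
  | insert a s ha ih => simp [Finset.sum_insert ha, hadd, ih]

theorem Finset.exists_mem_sum_eq_of_add_eq_max [CanonicallyOrderedAdd K]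
    (hadd : ∀ a b : K, a + b = max a b) {ι : Type*} (s : Finset ι) (f : ι → K)
    (h : ∑ i ∈ s, f i ≠ 0) : ∃ i ∈ s, ∑ j ∈ s, f j = f i := by
  have hs : s.Nonempty := by
    rw [Finset.nonempty_iff_ne_empty]
    rintro rfl
    simp at h
  obtain ⟨i, hi, hmax⟩ := s.exists_max_image f hs
  exact ⟨i, hi, le_antisymm ((sum_le_iff_of_add_eq_max hadd s f _).2 hmax)
    ((sum_le_iff_of_add_eq_max hadd s f _).1 le_rfl i hi)⟩

theorem canonicallyOrderedAdd_of_add_eq_max (hadd : ∀ a b : K, a + b = max a b) :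
    CanonicallyOrderedAdd K where
  exists_add_of_le {a b} h := ⟨b, by rw [hadd, max_eq_right h]⟩
  le_add_self a b := by rw [hadd]; exact le_max_right _ _
  le_self_add a b := by rw [hadd]; exact le_max_left _ _

theorem isOrderedRing_of_add_eq_max (hadd : ∀ a b : K, a + b = max a b) : IsOrderedRing K where
  add_le_add_left a b h c := by simp only [hadd]; exact max_le_max_right c h
  zero_le_one := by
    have := hadd 0 1
    rw [zero_add] at this
    exact max_eq_right_iff.1 this.symm
  mul_le_mul_of_nonneg_left a _ b c h := by
    have h1 : a * b + a * c = a * c := by rw [← mul_add, hadd, max_eq_right h]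
    rw [hadd] at h1
    exact max_eq_right_iff.1 h1
  mul_le_mul_of_nonneg_right a _ b c h := by
    have h1 : b * a + c * a = c * a := by rw [← add_mul, hadd, max_eq_right h]
    rw [hadd] at h1
    exact max_eq_right_iff.1 h1

/-- Existence of optimal dual potentials for the assignment problem whose optimal assignment is
the identity. -/
theorem Matrix.exists_potential [IsOrderedRing K] [CanonicallyOrderedAdd K] {ι : Type*}
    [Fintype ι] [DecidableEq ι] (B : Matrix ι ι K) (hdiag : ∀ i, B i i = 1)
    (hperm : ∀ τ : Equiv.Perm ι, ∏ x, B x (τ x) ≤ 1) :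
    ∃ u : ι → K, (∀ i, u i ≠ 0) ∧ ∀ i j, B i j * u j ≤ u i := by
  have hmax : ∀ i, ∃ w : K, (∃ l : List ι, (i :: l).Nodup ∧ B.pathWeight (i :: l) = w) ∧
      ∀ l : List ι, (i :: l).Nodup → B.pathWeight (i :: l) ≤ w := by
    intro i
    have : Finite {l : List ι // l.Nodup} := @Finite.of_fintype _ fintypeNodupList
    have : Finite {l : List ι // (i :: l).Nodup} :=
      Finite.of_injective
        (fun l => (⟨l.1, (List.nodup_cons.1 l.2).2⟩ : {l : List ι // l.Nodup}))
        fun a b h => by simpa [Subtype.ext_iff] using h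
    have : Nonempty {l : List ι // (i :: l).Nodup} := ⟨⟨[], by simp⟩⟩
    obtain ⟨l, hl⟩ := Finite.exists_max
      fun l : {l : List ι // (i :: l).Nodup} => B.pathWeight (i :: l.1)
    exact ⟨_, ⟨l.1, l.2, rfl⟩, fun l' h => hl ⟨l', h⟩⟩
  choose u hu hle using hmax
  refine ⟨u, fun i => ?_, fun k i => ?_⟩
  · have h := hle i [] (by simp)
    simp only [pathWeight] at h
    exact (zero_lt_one.trans_le h).ne'
  · obtain ⟨l, hl, hw⟩ := hu i
    rw [← hw]
    by_cases hk : k ∈ i :: l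
    · obtain ⟨s, t, hst⟩ := List.append_of_mem hk
      rw [hst] at hl ⊢
      rw [pathWeight_append_cons, ← mul_assoc]
      have hkt : (k :: t).Nodup := (List.nodup_append.1 hl).2.1
      have hsk : (s ++ [k]).Nodup := by
        refine hl.sublist ?_
        simp
      obtain ⟨τ, -, hhead, hprod⟩ := B.exists_perm_pathWeight_mul hdiag s k hsk
      have hτ : τ k = i := by
        have h2 : (s ++ [k]).head? = (i :: l).head? := by
          rw [hst]; cases s <;> simp
        rw [hhead] at h2
        simpa using h2
      have hcyc : B k i * B.pathWeight (s ++ [k]) ≤ 1 := by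
        rw [← hprod, ← hτ, Finset.mul_prod_erase _ (fun x => B x (τ x)) (Finset.mem_univ k)]
        exact hperm τ
      calc _ ≤ 1 * B.pathWeight (k :: t) := by gcongr
        _ ≤ u k := by rw [one_mul]; exact hle k t hkt
    · exact hle k (i :: l) (List.nodup_cons.2 ⟨hk, hl⟩)

/-- Rows and columns of a matrix can be scaled so that an optimal assignment has unit weights and
all entries are at most one. -/
theorem Matrix.exists_scaling [IsOrderedRing K] [CanonicallyOrderedAdd K] {ι : Type*}
    [Fintype ι] [DecidableEq ι] (A : Matrix ι ι K) (σ : Equiv.Perm ι)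
    (hσ : ∏ i, A i (σ i) ≠ 0)
    (hmax : ∀ τ : Equiv.Perm ι, ∏ i, A i (τ i) ≤ ∏ i, A i (σ i)) :
    ∃ r c : ι → K, (∀ i, r i ≠ 0) ∧ (∀ j, c j ≠ 0) ∧ (∀ i, r i * A i (σ i) * c (σ i) = 1) ∧
      ∀ i j, r i * A i j * c j ≤ 1 := by
  have hne : ∀ i, A i (σ i) ≠ 0 := fun i => Finset.prod_ne_zero_iff.1 hσ i (Finset.mem_univ i)
  obtain ⟨u, hu, hle⟩ := Matrix.exists_potential
    (Matrix.of fun i j => A i (σ j) * (A j (σ j))⁻¹)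
    (fun i => mul_inv_cancel₀ (hne i)) (by
      intro τ
      simp only [Matrix.of_apply, Finset.prod_mul_distrib, Finset.prod_inv_distrib]
      rw [Equiv.prod_comp τ fun i => A i (σ i), ← mul_inv_cancel₀ hσ]
      exact mul_le_mul_left (hmax (σ * τ)) _)
  refine ⟨fun i => (u i)⁻¹, fun j => (A (σ.symm j) j)⁻¹ * u (σ.symm j),
    fun i => inv_ne_zero (hu i), fun j => mul_ne_zero (inv_ne_zero ?_) (hu _), fun i => ?_,
    fun i j => ?_⟩
  · simpa using hne (σ.symm j)
  · have := hne i
    have := hu i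
    simp only [Equiv.symm_apply_apply]
    field_simp
  · have h := mul_le_mul_right (hle i (σ.symm j)) (u i)⁻¹
    rw [inv_mul_cancel₀ (hu i)] at h
    simpa [mul_assoc] using h

theorem Matrix.TropStarSingular.of_scaled_submatrix {K : Type*} [Semifield K]
    {m n m' n' : Type*} [Fintype n] [Fintype n'] (A : Matrix m n K) (f : m' → m) (e : n' → n)
    (he : Function.Injective e) (r : m' → K) (c : n' → K) (hr : ∀ i, r i ≠ 0) (hc : ∀ j, c j ≠ 0)
    (hrow : ∀ i, i ∈ Set.range f ∨ ∀ j, A i (e j) = 0)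
    (h : (Matrix.of fun i j => r i * A (f i) (e j) * c j).TropStarSingular) :
    A.TropStarSingular := by
  obtain ⟨x₁, x₂, hdisj, hne, heq⟩ := h
  let y : (n' → K) → n → K := fun x => Function.extend e (fun j => c j * x j) 0
  have hy : ∀ x j, y x (e j) = c j * x j := fun x j => he.extend_apply _ _ _
  have hy0 : ∀ x k, k ∉ Set.range e → y x k = 0 := fun x k hk =>
    Function.extend_apply' _ _ _ hk
  have hmul : ∀ x i, A.mulVec (y x) i = ∑ j, A i (e j) * (c j * x j) := by
    intro x i
    refine (Fintype.sum_of_injective e he _ _ (fun k hk => ?_) fun j => ?_).symm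
    · simp [hy0 x k hk]
    · simp [hy]
  refine ⟨y x₁, y x₂, fun k => ?_, fun h0 => hne ?_, ?_⟩
  · by_cases hk : k ∈ Set.range e
    · obtain ⟨j, rfl⟩ := hk
      rw [hy, hy]
      exact (hdisj j).imp (fun h => by simp [h]) fun h => by simp [h]
    · exact Or.inl (hy0 _ _ hk)
  · ext j
    have := congrFun h0 (e j)
    rw [Pi.add_apply, hy, hy, ← mul_add] at this
    exact (mul_eq_zero.1 this).resolve_left (hc j)
  · ext i
    rw [hmul, hmul]
    rcases hrow i with ⟨i, rfl⟩ | h0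
    · apply mul_left_cancel₀ (hr i)
      have := congrFun heq i
      simp only [Matrix.mulVec, dotProduct, Matrix.of_apply] at this
      simpa only [Finset.mul_sum, mul_assoc] using this
    · simp [h0]

/-- Greedy extension of a partial solution of `A x₁ = A x₂`: if the rows in `S` are balanced and
dominate all the others, the remaining rows can be balanced one after the other. -/
theorem Matrix.TropStarSingular.of_balanced_on [IsOrderedRing K] [CanonicallyOrderedAdd K]
    (hadd : ∀ a b : K, a + b = max a b) {ι n : Type*} [Fintype ι] [Fintype n]
    (A : Matrix ι n K) (p : ι → n) (hp : Function.Injective p) (h1 : ∀ i, A i (p i) = 1)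
    (hle : ∀ l i, A l (p i) ≤ 1) (S : Finset ι) (x₁ x₂ : n → K)
    (hdisj : ∀ k, x₁ k = 0 ∨ x₂ k = 0) (hsupp : ∀ i ∉ S, x₁ (p i) = 0 ∧ x₂ (p i) = 0)
    (hbal : ∀ i ∈ S, A.mulVec x₁ i = A.mulVec x₂ i)
    (hdom : ∀ s ∈ S, ∀ l ∉ S, A.mulVec x₁ l ≤ A.mulVec x₁ s ∧ A.mulVec x₂ l ≤ A.mulVec x₁ s)
    (hne : x₁ + x₂ ≠ 0) : A.TropStarSingular := by
  classical
  induction hN : (Finset.univ \ S).card generalizing S x₁ x₂ with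
  | zero =>
    rw [Finset.card_eq_zero, Finset.sdiff_eq_empty_iff_subset] at hN
    exact ⟨x₁, x₂, hdisj, hne, funext fun i => hbal i (hN (Finset.mem_univ i))⟩
  | succ N ih =>
    obtain ⟨i, hi, hmax⟩ := (Finset.univ \ S).exists_max_image
      (fun l => max (A.mulVec x₁ l) (A.mulVec x₂ l)) (Finset.card_pos.1 (by omega))
    have hiS : i ∉ S := (Finset.mem_sdiff.1 hi).2
    wlog hw : A.mulVec x₁ i ≤ A.mulVec x₂ i generalizing x₁ x₂
    · refine this x₂ x₁ (fun k => (hdisj k).symm) (fun i hi => (hsupp i hi).symm)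
        (fun i hi => (hbal i hi).symm) (fun s hs l hl => ?_) (by rwa [add_comm]) ?_ (le_of_not_ge hw)
      · rw [← hbal s hs]
        exact (hdom s hs l hl).symm
      · simpa only [max_comm] using hmax
    set w := A.mulVec x₂ i with hwdef
    have hval : ∀ l, A.mulVec (x₁ + Pi.single (p i) w) l = A.mulVec x₁ l + A l (p i) * w := by
      intro l
      rw [Matrix.mulVec_add, Pi.add_apply]
      simp [Matrix.mulVec_single]
    have hsmall : ∀ l, A l (p i) * w ≤ w := fun l => mul_le_of_le_one_left' (hle l i)
    have hvi : A.mulVec (x₁ + Pi.single (p i) w) i = w := by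
      rw [hval, h1, one_mul, hadd, max_eq_right hw]
    have hvS : ∀ s ∈ S, A.mulVec (x₁ + Pi.single (p i) w) s = A.mulVec x₁ s := by
      intro s hs
      rw [hval, hadd, max_eq_left ((hsmall s).trans (hdom s hs i hiS).2)]
    have hvl : ∀ l ∉ S, A.mulVec (x₁ + Pi.single (p i) w) l ≤ w ∧ A.mulVec x₂ l ≤ w := by
      intro l hl
      have h := hmax l (by simp [hl])
      rw [max_eq_right hw, max_le_iff] at h
      refine ⟨?_, h.2⟩
      rw [hval, hadd]
      exact max_le h.1 (hsmall l)
    refine ih (insert i S) (x₁ + Pi.single (p i) w) x₂ ?_ ?_ ?_ ?_ ?_ ?_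
    · intro k
      by_cases hk : k = p i
      · subst hk
        exact Or.inr (hsupp i hiS).2
      · simpa [hk] using hdisj k
    · intro l hl
      simp only [Finset.mem_insert, not_or] at hl
      simpa [hp.ne hl.1] using hsupp l hl.2
    · intro s hs
      rcases Finset.mem_insert.1 hs with rfl | hs
      · exact hvi
      · rw [hvS s hs, hbal s hs]
    · intro s hs l hl
      simp only [Finset.mem_insert, not_or] at hl
      rcases Finset.mem_insert.1 hs with rfl | hs
      · rw [hvi]
        exact hvl l hl.2
      · rw [hvS s hs]
        have hws : w ≤ A.mulVec x₁ s := (hdom s hs i hiS).2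
        exact (hvl l hl.2).imp (fun h => h.trans hws) fun h => h.trans hws
    · intro h0
      apply hne
      ext k
      have := congrFun h0 k
      simp only [Pi.add_apply, Pi.zero_apply, add_eq_zero] at this ⊢
      exact ⟨this.1.1, this.2⟩
    · have h2 : Finset.univ \ insert i S = (Finset.univ \ S).erase i := by
        ext; simp [not_or]
      rw [h2, Finset.card_erase_of_mem hi, hN, Nat.add_sub_cancel]

/-- A matrix with one more column than rows whose remaining columns have a nonzero assignment is
*singular. -/
theorem Matrix.TropStarSingular.of_option [IsOrderedRing K] [CanonicallyOrderedAdd K]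
    (hadd : ∀ a b : K, a + b = max a b) {ι : Type*} [Fintype ι]
    (A : Matrix ι (Option ι) K) (hA : ∏ i, A i (some i) ≠ 0) : A.TropStarSingular := by
  classical
  obtain ⟨σ, hσ⟩ := Finite.exists_max fun τ : Equiv.Perm ι => ∏ i, A i (some (τ i))
  have h0 : ∏ i, A i (some (σ i)) ≠ 0 := by
    intro h
    have := hσ 1
    rw [h] at this
    exact hA (nonpos_iff_eq_zero.1 this)
  obtain ⟨r, c, hr, hc, h1, hle⟩ :=
    Matrix.exists_scaling (Matrix.of fun i j => A i (some j)) σ h0 hσ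
  refine .of_scaled_submatrix A id id Function.injective_id r (fun j => j.elim 1 c) hr
    (fun j => ?_) (fun i => Or.inl ⟨i, rfl⟩) ?_
  · cases j with
    | none => simp
    | some j => exact hc j
  · refine .of_balanced_on hadd _ (fun i => some (σ i))
      ((Option.some_injective _).comp σ.injective) h1 (fun l i => hle l (σ i)) ∅
      (Pi.single none 1) 0 (by simp) (by simp) (by simp) (by simp) ?_
    simp

/-- A square matrix over which every assignment vanishes is *singular. -/
theorem Matrix.TropStarSingular.of_forall_prod_eq_zero [IsOrderedRing K] [CanonicallyOrderedAdd K]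
    (hadd : ∀ a b : K, a + b = max a b) {n : Type*} [Fintype n]
    (A : Matrix n n K) (hA : ∀ σ : Equiv.Perm n, ∏ i, A i (σ i) = 0) : A.TropStarSingular := by
  classical
  let t : n → Finset n := fun j => Finset.univ.filter fun i => A i j ≠ 0
  have hHall : ∃ s : Finset n, (s.biUnion t).card < s.card := by
    by_contra! h
    obtain ⟨f, hf, hft⟩ := (Finset.all_card_le_biUnion_card_iff_exists_injective t).1 h
    let σ : Equiv.Perm n := Equiv.ofBijective f (Finite.injective_iff_bijective.1 hf)
    obtain ⟨i, -, hi⟩ := Finset.prod_eq_zero_iff.1 (hA σ.symm)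
    have := hft (σ.symm i)
    rw [show f (σ.symm i) = i from σ.apply_symm_apply i] at this
    exact (Finset.mem_filter.1 this).2 hi
  obtain ⟨s, hs, hmin⟩ := WellFounded.has_min
    (InvImage.wf Finset.card (Nat.lt_wfRel.wf) : WellFounded fun a b : Finset n => a.card < b.card)
    {s | (s.biUnion t).card < s.card} hHall
  obtain ⟨j₀, hj₀⟩ : s.Nonempty := Finset.card_pos.1 (lt_of_le_of_lt (Nat.zero_le _) hs)
  obtain ⟨f, hf, hft⟩ := (Finset.all_card_le_biUnion_card_iff_exists_injective
      fun j : {j // j ∈ s.erase j₀} => t j.1).1 (by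
    intro s'
    by_contra! h
    have hsub : s'.map (Function.Embedding.subtype _) ⊆ s.erase j₀ := by
      intro j hj
      obtain ⟨j', -, rfl⟩ := Finset.mem_map.1 hj
      exact j'.2
    refine hmin (s'.map (Function.Embedding.subtype _)) ?_ ?_
    · change ((s'.map _).biUnion t).card < (s'.map _).card
      rw [Finset.card_map]
      simpa [Finset.map_eq_image, Finset.image_biUnion] using h
    · exact (Finset.card_le_card hsub).trans_lt (Finset.card_erase_lt_of_mem hj₀))
  have hrange : Finset.univ.image f = s.biUnion t := by
    apply Finset.eq_of_subset_of_card_le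
    · intro i hi
      obtain ⟨j, -, rfl⟩ := Finset.mem_image.1 hi
      exact Finset.mem_biUnion.2 ⟨j.1, Finset.mem_of_mem_erase j.2, hft j⟩
    · rw [Finset.card_image_of_injective _ hf, Finset.card_univ, Fintype.card_coe,
        Finset.card_erase_of_mem hj₀]
      change (s.biUnion t).card < s.card at hs
      omega
  let e : Option {j // j ∈ s.erase j₀} → n := fun j => j.elim j₀ Subtype.val
  have hes : ∀ j, e j ∈ s := by
    rintro (_ | j)
    · exact hj₀
    · exact Finset.mem_of_mem_erase j.2
  have he : Function.Injective e := by
    rintro (_ | a) (_ | b) h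
    · rfl
    · exact absurd h.symm (Finset.ne_of_mem_erase b.2)
    · exact absurd h (Finset.ne_of_mem_erase a.2)
    · exact congrArg some (Subtype.ext h)
  refine .of_scaled_submatrix A f e he 1 1 (by simp) (by simp) (fun i => ?_)
    (.of_option hadd _ ?_)
  · by_contra! h
    obtain ⟨hi, j, hj⟩ := h
    have : i ∈ Finset.univ.image f := by
      rw [hrange]
      exact Finset.mem_biUnion.2 ⟨e j, hes j, by simpa [t] using hj⟩
    exact hi (by simpa using this)
  · refine Finset.prod_ne_zero_iff.2 fun j _ => ?_
    simpa [t, e] using hft j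

/-- A square matrix with two optimal assignments of opposite signs is *singular. -/
theorem Matrix.TropStarSingular.of_optimal_perms [IsOrderedRing K] [CanonicallyOrderedAdd K]
    (hadd : ∀ a b : K, a + b = max a b) {n : Type*} [Fintype n] [DecidableEq n]
    (A : Matrix n n K) (σ τ : Equiv.Perm n) (hσ : ∏ i, A i (σ i) ≠ 0)
    (hmax : ∀ π : Equiv.Perm n, ∏ i, A i (π i) ≤ ∏ i, A i (σ i))
    (hτ : ∏ i, A i (τ i) = ∏ i, A i (σ i))
    (hsign : Equiv.Perm.sign τ = -Equiv.Perm.sign σ) : A.TropStarSingular := by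
  classical
  obtain ⟨r, c, hr, hc, h1, hle⟩ := A.exists_scaling σ hσ hmax
  refine .of_scaled_submatrix A id id Function.injective_id r c hr hc
    (fun i => Or.inl ⟨i, rfl⟩) ?_
  set C : Matrix n n K := Matrix.of fun i j => r i * A i j * c j with hC
  change C.TropStarSingular
  have hCle : ∀ i j, C i j ≤ 1 := hle
  have hprod : ∀ π : Equiv.Perm n,
      ∏ i, C i (π i) = (∏ i, r i) * (∏ i, A i (π i)) * ∏ i, c i := by
    intro π
    rw [← Equiv.prod_comp π c]
    simp [hC, Finset.prod_mul_distrib]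
  have hτ1 : ∀ i, C i (τ i) = 1 := by
    have h : ∏ i, C i (τ i) = 1 := by
      rw [hprod, hτ, ← hprod]
      exact Finset.prod_eq_one fun i _ => h1 i
    intro i
    exact (Finset.prod_eq_one_iff_of_le_one' fun i _ => hle i (τ i)).1 h i (Finset.mem_univ i)
  obtain ⟨s, q, ⟨j₀, hj₀⟩, hsq⟩ := (τ * σ⁻¹).exists_alternating_of_sign_eq_neg_one (by
    rw [Equiv.Perm.sign_mul, Equiv.Perm.sign_inv, hsign, neg_mul, Int.units_mul_self])
  let v : (n → Prop) → n → K := fun P j => if j ∈ s ∧ P j then 1 else 0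
  have hv : ∀ P l, C.mulVec (v P) l ≤ 1 := by
    intro P l
    refine (Finset.sum_le_iff_of_add_eq_max hadd _ _ _).2 fun j _ => ?_
    by_cases h : j ∈ s ∧ P j
    · simpa only [v, if_pos h, mul_one] using hCle l j
    · simp [v, h]
  have hv1 : ∀ P l j, j ∈ s → P j → C l j = 1 → C.mulVec (v P) l = 1 := by
    intro P l j hj hP hl
    refine le_antisymm (hv P l) ?_
    have := Finset.single_le_sum_of_canonicallyOrdered
      (f := fun j => C l j * v P j) (Finset.mem_univ j)
    rwa [hl, one_mul, show v P j = 1 from if_pos ⟨hj, hP⟩] at this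
  have hS : ∀ l, σ l ∈ s → C.mulVec (v q) l = 1 ∧ C.mulVec (v fun j => ¬ q j) l = 1 := by
    intro l hl
    obtain ⟨hs', hq⟩ := hsq _ hl
    simp only [Equiv.Perm.mul_apply, Equiv.Perm.inv_def, Equiv.symm_apply_apply] at hs' hq
    by_cases h : q (σ l)
    · exact ⟨hv1 _ l _ hl h (h1 l), hv1 _ l _ hs' (by tauto) (hτ1 l)⟩
    · exact ⟨hv1 _ l _ hs' (by tauto) (hτ1 l), hv1 _ l _ hl h (h1 l)⟩
  refine .of_balanced_on hadd C σ σ.injective h1 (fun l i => hle l (σ i))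
    (Finset.univ.filter fun i => σ i ∈ s) (v q) (v fun j => ¬ q j) (fun k => ?_)
    (fun i hi => ?_) (fun i hi => ?_) (fun i hi l _ => ?_) (fun h => ?_)
  · by_cases h : q k <;> simp [v, h]
  · have : σ i ∉ s := by simpa using hi
    simp [v, this]
  · have := hS i (by simpa using hi)
    rw [this.1, this.2]
  · rw [(hS i (by simpa using hi)).1]
    exact ⟨hv _ l, hv _ l⟩
  · have := congrFun h j₀
    by_cases h : q j₀ <;> simp [v, hj₀, h] at this

/-- For a *singular matrix, every assignment is dominated by one of the opposite sign. -/
theorem Matrix.TropStarSingular.exists_perm_ge [IsOrderedRing K] [CanonicallyOrderedAdd K]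
    (hadd : ∀ a b : K, a + b = max a b) {n : Type*} [Fintype n] [DecidableEq n]
    {A : Matrix n n K} (hA : A.TropStarSingular) (σ : Equiv.Perm n) (hσ : ∏ i, A i (σ i) ≠ 0) :
    ∃ τ : Equiv.Perm n, Equiv.Perm.sign τ = -Equiv.Perm.sign σ ∧
      ∏ i, A i (σ i) ≤ ∏ i, A i (τ i) := by
  classical
  obtain ⟨x₁, x₂, hdisj, hne, heq⟩ := hA
  have hσi : ∀ i, A i (σ i) ≠ 0 := fun i => Finset.prod_ne_zero_iff.1 hσ i (Finset.mem_univ i)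
  have step : ∀ y z : n → K, A.mulVec y = A.mulVec z → ∀ j, y j ≠ 0 →
      ∃ k, z k ≠ 0 ∧ A (σ.symm j) j * y j ≤ A (σ.symm j) k * z k := by
    intro y z hyz j hj
    set i := σ.symm j
    have hij : A i j ≠ 0 := by simpa [i] using hσi i
    have h1 : A i j * y j ≤ A.mulVec z i := by
      rw [← hyz]
      exact Finset.single_le_sum_of_canonicallyOrdered
        (f := fun j => A i j * y j) (Finset.mem_univ j)
    have hpos : 0 < A i j * y j := pos_iff_ne_zero.2 (mul_ne_zero hij hj)
    obtain ⟨k, -, hk⟩ := Finset.exists_mem_sum_eq_of_add_eq_max hadd Finset.univ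
      (fun k => A i k * z k) (hpos.trans_le h1).ne'
    have h2 : A i j * y j ≤ A i k * z k := h1.trans_eq hk
    exact ⟨k, right_ne_zero_of_mul (hpos.trans_le h2).ne', h2⟩
  have hx : ∀ j, (x₁ j ≠ 0 → x₁ j + x₂ j = x₁ j) ∧ (x₂ j ≠ 0 → x₁ j + x₂ j = x₂ j) := by
    intro j
    rcases hdisj j with h | h <;> simp [h]
  let J := {j // x₁ j + x₂ j ≠ 0}
  have hf : ∀ j : J, ∃ k : J, (x₁ k.1 ≠ 0 ↔ ¬ x₁ j.1 ≠ 0) ∧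
      A (σ.symm j.1) j.1 * (x₁ j.1 + x₂ j.1) ≤ A (σ.symm j.1) k.1 * (x₁ k.1 + x₂ k.1) := by
    rintro ⟨j, hj⟩
    by_cases h : x₁ j = 0
    · have h2 : x₂ j ≠ 0 := by simpa [h] using hj
      obtain ⟨k, hk, hle⟩ := step x₂ x₁ heq.symm j h2
      rw [← (hx k).1 hk, ← (hx j).2 h2] at hle
      exact ⟨⟨k, by rwa [(hx k).1 hk]⟩, by simp [h, hk], hle⟩
    · obtain ⟨k, hk, hle⟩ := step x₁ x₂ heq j h
      have hk1 := (hdisj k).resolve_right hk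
      rw [← (hx k).2 hk, ← (hx j).1 h] at hle
      exact ⟨⟨k, by rwa [(hx k).2 hk]⟩, by simp [h, hk1], hle⟩
  choose f hfp hfle using hf
  have : Nonempty J := by
    obtain ⟨j, hj⟩ := Function.ne_iff.1 hne
    exact ⟨⟨j, hj⟩⟩
  obtain ⟨c, hc, hcf⟩ := exists_odd_perm_of_alternating f (fun j => x₁ j.1 ≠ 0) hfp
  let c' : Equiv.Perm n := Equiv.Perm.ofSubtype c
  let w : n → K := fun j => if x₁ j + x₂ j = 0 then 1 else x₁ j + x₂ j
  have hw : ∀ j : J, w j.1 = x₁ j.1 + x₂ j.1 := fun j => if_neg j.2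
  have hw0 : ∏ i, w i ≠ 0 := Finset.prod_ne_zero_iff.2 fun j _ => by
    by_cases h : x₁ j + x₂ j = 0
    · simp only [w, if_pos h]; exact one_ne_zero
    · simp only [w, if_neg h]; exact h
  have hterm : ∀ i, A i (σ i) * w (σ i) ≤ A i (c' (σ i)) * w (c' (σ i)) := by
    intro i
    by_cases h : x₁ (σ i) + x₂ (σ i) = 0
    · rw [show c' (σ i) = σ i from Equiv.Perm.ofSubtype_apply_of_not_mem c (by simpa using h)]
    · have hci : c' (σ i) = (c ⟨σ i, h⟩).1 := Equiv.Perm.ofSubtype_apply_of_mem c h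
      rw [hci]
      rcases hcf ⟨σ i, h⟩ with h' | h'
      · rw [h']
      · rw [h', hw, hw ⟨σ i, h⟩]
        simpa using hfle ⟨σ i, h⟩
  refine ⟨c' * σ, ?_, ?_⟩
  · rw [Equiv.Perm.sign_mul, Equiv.Perm.sign_ofSubtype, hc, neg_one_mul]
  · have h := Finset.prod_le_prod' fun i (_ : i ∈ Finset.univ) => hterm i
    have h2 := Equiv.prod_comp (c' * σ) w
    simp only [Equiv.Perm.mul_apply] at h2
    rw [Finset.prod_mul_distrib, Finset.prod_mul_distrib, Equiv.prod_comp σ w, h2] at h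
    have h3 := mul_le_mul_left h (∏ i, w i)⁻¹
    simpa only [mul_assoc, mul_inv_cancel₀ hw0, mul_one, Equiv.Perm.mul_apply] using h3

end Ordered

theorem starSingular_iff_detp_eq_detm {K : Type*} [Semifield K] [LinearOrder K]
    (hadd : ∀ a b : K, a + b = max a b) {n : ℕ} (A : Matrix (Fin n) (Fin n) K) :
    A.TropStarSingular ↔
      ∑ σ ∈ Finset.univ.filter (fun σ : Equiv.Perm (Fin n) => Equiv.Perm.sign σ = 1),
          ∏ i, A i (σ i) =
        ∑ σ ∈ Finset.univ.filter (fun σ : Equiv.Perm (Fin n) => Equiv.Perm.sign σ ≠ 1),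
          ∏ i, A i (σ i) := by
  have := canonicallyOrderedAdd_of_add_eq_max hadd
  have := isOrderedRing_of_add_eq_max hadd
  constructor
  · intro hA
    apply le_antisymm <;> refine (Finset.sum_le_iff_of_add_eq_max hadd _ _ _).2 fun σ hσ => ?_
    all_goals
      rcases eq_or_ne (∏ i, A i (σ i)) 0 with h0 | h0
      · rw [h0]
        exact zero_le
      obtain ⟨τ, hτ, hle⟩ := hA.exists_perm_ge hadd σ h0
      refine hle.trans (Finset.single_le_sum_of_canonicallyOrdered
        (f := fun σ : Equiv.Perm (Fin n) => ∏ i, A i (σ i)) (i := τ) ?_)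
      simp only [Finset.mem_filter, Finset.mem_univ, true_and] at hσ ⊢
      rcases Int.units_eq_one_or (Equiv.Perm.sign σ) with h | h <;> simp_all
  · intro h
    have hle : ∀ π : Equiv.Perm (Fin n), ∏ i, A i (π i) ≤
        ∑ σ ∈ Finset.univ.filter (fun σ : Equiv.Perm (Fin n) => Equiv.Perm.sign σ = 1),
          ∏ i, A i (σ i) := by
      intro π
      by_cases hπ : Equiv.Perm.sign π = 1
      · exact Finset.single_le_sum_of_canonicallyOrdered
          (f := fun σ : Equiv.Perm (Fin n) => ∏ i, A i (σ i)) (by simp [hπ])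
      · rw [h]
        exact Finset.single_le_sum_of_canonicallyOrdered
          (f := fun σ : Equiv.Perm (Fin n) => ∏ i, A i (σ i)) (by simp [hπ])
    by_cases h0 : ∑ σ ∈ Finset.univ.filter (fun σ : Equiv.Perm (Fin n) => Equiv.Perm.sign σ = 1),
          ∏ i, A i (σ i) = 0
    · exact .of_forall_prod_eq_zero hadd A fun σ => nonpos_iff_eq_zero.1 (h0 ▸ hle σ)
    · obtain ⟨σ, hσ, hσe⟩ := Finset.exists_mem_sum_eq_of_add_eq_max hadd _ _ h0
      obtain ⟨τ, hτ, hτe⟩ := Finset.exists_mem_sum_eq_of_add_eq_max hadd _ _ (h ▸ h0)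
      refine .of_optimal_perms hadd A σ τ (hσe ▸ h0) (hσe ▸ hle) (by rw [← hτe, ← h, hσe]) ?_
      simp only [Finset.mem_filter, Finset.mem_univ, true_and] at hσ hτ
      rw [hσ]
      exact (Int.units_eq_one_or _).resolve_left hτ
end

section
/- Let K be a linearly ordered idempotent semifield and A : Matrix (Fin n) (Fin n) K a square matrix. Then A is regular if and only if its transpose Aᵀ is regular, and A is *regular if and only if Aᵀ is *regular. -/
/-- A matrix is singular if it admits an orthogonal decomposition `A = A₁ + A₂`
(entrywise disjoint supports) together with a nonzero vector `x` with `A₁ x = A₂ x`. -/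
def Matrix.TropSingular {K : Type*} [Semifield K] {m n : Type*} [Fintype n]
    (A : Matrix m n K) : Prop :=
  ∃ A₁ A₂ : Matrix m n K, A = A₁ + A₂ ∧ (∀ i j, A₁ i j = 0 ∨ A₂ i j = 0) ∧
    ∃ x : n → K, x ≠ 0 ∧ A₁.mulVec x = A₂.mulVec x

/-- A semifield with a linear order in which addition is the maximum. -/
class IsMaxAdd (K : Type*) [Semifield K] [LinearOrder K] : Prop where
  add_eq_max : ∀ a b : K, a + b = max a b

namespace IsMaxAdd

variable {K : Type*} [Semifield K] [LinearOrder K] [IsMaxAdd K]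

instance : CanonicallyOrderedAdd K where
  exists_add_of_le {a b} h := ⟨b, by rw [add_eq_max, max_eq_right h]⟩
  le_add_self a b := by rw [add_eq_max]; exact le_max_right _ _
  le_self_add a b := by rw [add_eq_max]; exact le_max_left _ _

instance : IsOrderedRing K where
  add_le_add_left a b hab c := by
    simp only [add_eq_max]; exact max_le_max_right _ hab
  zero_le_one := zero_le
  mul_le_mul_of_nonneg_left a _ b c h := by
    show a * b ≤ a * c
    have := mul_add a b c
    rw [add_eq_max, max_eq_right h, add_eq_max] at this
    rw [this]; exact le_max_left _ _
  mul_le_mul_of_nonneg_right a _ b c h := by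
    show b * a ≤ c * a
    have := add_mul b c a
    rw [add_eq_max, max_eq_right h, add_eq_max] at this
    rw [this]; exact le_max_left _ _

instance : PosMulStrictMono K := PosMulMono.toPosMulStrictMono

instance : MulPosStrictMono K := MulPosMono.toMulPosStrictMono

lemma le_sum {ι : Type*} [Fintype ι] (p : ι → K) (i : ι) : p i ≤ ∑ j, p j :=
  Finset.single_le_sum_of_canonicallyOrdered (Finset.mem_univ i)

lemma exists_eq_sum {ι : Type*} (p : ι → K) (t : Finset ι) (ht : t.Nonempty) :
    ∃ i ∈ t, ∑ j ∈ t, p j = p i := by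
  classical
  induction ht using Finset.Nonempty.cons_induction with
  | singleton a => exact ⟨a, by simp⟩
  | cons a s h hs ih =>
    obtain ⟨i, hi, e⟩ := ih
    rw [Finset.sum_cons, e, add_eq_max]
    rcases max_choice (p a) (p i) with h' | h'
    · exact ⟨a, by simp, h'⟩
    · exact ⟨i, by simp [hi], h'⟩

/-- Two sums agree iff the overall maximum is zero or is attained on both sides. -/
lemma sum_eq_sum_iff {ι : Type*} [Fintype ι] {p q : ι → K} :
    ∑ l, p l = ∑ l, q l ↔ (∀ l, p l + q l = 0) ∨
      ∃ j k, p j ≠ 0 ∧ p j = q k ∧ ∀ l, p l + q l ≤ p j := by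
  constructor
  · intro e
    by_cases h0 : ∑ l, p l = 0
    · left
      intro l
      have h1 := le_sum p l
      have h2 := le_sum q l
      rw [← e, h0] at h2
      rw [h0] at h1
      rw [nonpos_iff_eq_zero.1 h1, nonpos_iff_eq_zero.1 h2, add_zero]
    · right
      have hne : (Finset.univ : Finset ι).Nonempty := by
        rw [Finset.nonempty_iff_ne_empty]
        intro hemp; simp [hemp] at h0
      obtain ⟨j, -, hj⟩ := exists_eq_sum p _ hne
      obtain ⟨k, -, hk⟩ := exists_eq_sum q _ hne
      refine ⟨j, k, hj ▸ h0, by rw [← hj, e, hk], fun l => ?_⟩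
      rw [add_eq_max]
      refine max_le (hj ▸ le_sum p l) ?_
      rw [← hj, e]
      exact le_sum q l
  · rintro (h0 | ⟨j, k, -, hjk, hle⟩)
    · refine Finset.sum_congr rfl fun l _ => ?_
      obtain ⟨h1, h2⟩ := add_eq_zero.1 (h0 l)
      rw [h1, h2]
    · have hne : (Finset.univ : Finset ι).Nonempty := ⟨j, Finset.mem_univ _⟩
      obtain ⟨a, -, ha⟩ := exists_eq_sum p _ hne
      obtain ⟨b, -, hb⟩ := exists_eq_sum q _ hne
      apply le_antisymm
      · calc ∑ l, p l = p a := ha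
          _ ≤ p a + q a := le_self_add
          _ ≤ q k := hjk ▸ hle a
          _ ≤ _ := le_sum q k
      · calc ∑ l, q l = q b := hb
          _ ≤ p b + q b := le_add_self
          _ ≤ p j := hle b
          _ ≤ _ := le_sum p j

end IsMaxAdd

/-- `A` is dependent with respect to colours in `X` if for some nonzero vector `x` and some
colouring of the columns, in every row of `(A i j * x j)` the maximum is zero or is attained in
columns of two different colours. -/
def Matrix.ColorSingular (X : Type*) {I J K : Type*} [Semifield K] [LinearOrder K]
    (A : Matrix I J K) : Prop :=
  ∃ x : J → K, x ≠ 0 ∧ ∃ s : J → X, ∀ i, (∀ j, A i j * x j = 0) ∨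
    ∃ j k, s j ≠ s k ∧ A i j * x j = A i k * x k ∧ ∀ l, A i l * x l ≤ A i j * x j

/-- A bijection of part of `V` onto itself along `f`, extended by the identity. -/
lemma exists_perm_of_mapsTo {V : Type*} [Fintype V] (f : V → V) (S : Finset V)
    (hS : S.Nonempty) (hf : ∀ i ∈ S, f i ∈ S) :
    ∃ (g : Equiv.Perm V) (T : Finset V), T ⊆ S ∧ T.Nonempty ∧
      (∀ i ∈ T, g i = f i ∧ f i ∈ T) ∧ ∀ i ∉ T, g i = i := by
  classical
  induction S using Finset.strongInduction with
  | H S ih =>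
    have hsub : S.image f ⊆ S := Finset.image_subset_iff.2 hf
    by_cases heq : S.image f = S
    · have hsurj : Function.Surjective (fun i => if i ∈ S then f i else i) := by
        intro j
        by_cases hj : j ∈ S
        · rw [← heq, Finset.mem_image] at hj
          obtain ⟨i, hi, rfl⟩ := hj
          exact ⟨i, by simp [hi]⟩
        · exact ⟨j, by simp [hj]⟩
      exact ⟨Equiv.ofBijective _ ⟨Finite.injective_iff_surjective.2 hsurj, hsurj⟩, S,
        subset_rfl, hS, fun i hi => ⟨if_pos hi, hf i hi⟩, fun i hi => if_neg hi⟩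
    · obtain ⟨g, T, hT, h⟩ := ih _ (hsub.ssubset_of_ne heq) (hS.image f)
        fun i hi => Finset.mem_image_of_mem f (hsub hi)
      exact ⟨g, T, hT.trans hsub, h⟩

namespace Matrix

variable {K : Type*} [Semifield K] [LinearOrder K] [IsMaxAdd K] {X : Type*}

lemma ColorSingular.of_scaled {I J I' J' : Type*} {A : Matrix I J K} {B : Matrix I' J' K}
    (ρ : I' ≃ I) (π : J' ≃ J) {u : I' → K} {v : J' → K} (hu : ∀ i, u i ≠ 0)
    (hv : ∀ j, v j ≠ 0) (h : ∀ i j, B i j = u i * A (ρ i) (π j) * v j)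
    (hB : B.ColorSingular X) : A.ColorSingular X := by
  obtain ⟨x, hx, s, hs⟩ := hB
  have key : ∀ i j, B i j * x j = u i * (A (ρ i) (π j) * (v j * x j)) := by
    intro i j; rw [h]; ring
  refine ⟨fun j => v (π.symm j) * x (π.symm j), ?_, s ∘ π.symm, fun i => ?_⟩
  · obtain ⟨j, hj⟩ := Function.ne_iff.1 hx
    refine Function.ne_iff.2 ⟨π j, ?_⟩
    simpa using ⟨hv j, hj⟩
  · have hpos : 0 < u (ρ.symm i) := pos_iff_ne_zero.2 (hu _)
    rcases hs (ρ.symm i) with h0 | ⟨j, k, hjk, he, hle⟩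
    · left
      intro j
      have := h0 (π.symm j)
      rw [key] at this
      simpa [hu] using this
    · right
      refine ⟨π j, π k, by simpa using hjk, ?_, fun l => ?_⟩
      · rw [key, key] at he
        simpa using mul_left_cancel₀ (hu _) he
      · have := hle (π.symm l)
        rw [key, key] at this
        simpa using le_of_mul_le_mul_left this hpos

lemma ColorSingular.scaled {I J I' J' : Type*} {A : Matrix I J K} {B : Matrix I' J' K}
    (ρ : I' ≃ I) (π : J' ≃ J) {u : I' → K} {v : J' → K} (hu : ∀ i, u i ≠ 0)
    (hv : ∀ j, v j ≠ 0) (h : ∀ i j, B i j = u i * A (ρ i) (π j) * v j)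
    (hA : A.ColorSingular X) : B.ColorSingular X := by
  refine hA.of_scaled ρ.symm π.symm (u := fun i => (u (ρ.symm i))⁻¹)
    (v := fun j => (v (π.symm j))⁻¹) (fun i => inv_ne_zero (hu _))
    (fun j => inv_ne_zero (hv _)) fun i j => ?_
  rw [h]
  have := hu (ρ.symm i)
  have := hv (π.symm j)
  simp only [Equiv.apply_symm_apply]
  field_simp

variable {V : Type*} [Fintype V]

/-- In a matrix with entries at most `1` and unit diagonal, dependence produces a nontrivial
permutation supported on unit entries which moves every point to one of another colour. -/
lemma ColorSingular.exists_perm {C : Matrix V V K} (hC : ∀ i j, C i j ≤ 1) (hd : ∀ i, C i i = 1)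
    (h : C.ColorSingular X) :
    ∃ (g : Equiv.Perm V) (s : V → X), g ≠ 1 ∧ (∀ i, C i (g i) = 1) ∧
      ∀ i, g i ≠ i → s (g i) ≠ s i := by
  classical
  obtain ⟨x, hx, s, hs⟩ := h
  obtain ⟨i₁, hi₁⟩ := Function.ne_iff.1 hx
  obtain ⟨i₀, -, hmax⟩ := Finset.exists_max_image Finset.univ x ⟨i₁, Finset.mem_univ _⟩
  have hpos : 0 < x i₀ := (pos_iff_ne_zero.2 hi₁).trans_le (hmax i₁ (Finset.mem_univ _))
  have hstep : ∀ i, ∃ j, x i = x i₀ → x j = x i₀ ∧ C i j = 1 ∧ s j ≠ s i := by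
    intro i
    by_cases hi : x i = x i₀
    swap
    · exact ⟨i, fun h => absurd h hi⟩
    have hatt : ∃ j, s j ≠ s i ∧ x i ≤ C i j * x j := by
      rcases hs i with h0 | ⟨j, k, hjk, he, hle⟩
      · have := h0 i
        rw [hd, one_mul, hi] at this
        exact absurd this hpos.ne'
      · have hii := hle i
        rw [hd, one_mul] at hii
        by_cases hj : s j = s i
        · exact ⟨k, fun hk => hjk (hj.trans hk.symm), he ▸ hii⟩
        · exact ⟨j, hj, hii⟩
    obtain ⟨j, hj, hle⟩ := hatt
    have hj' : x j = x i₀ := by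
      refine le_antisymm (hmax j (Finset.mem_univ _)) ?_
      rw [← hi]
      exact hle.trans (mul_le_of_le_one_left zero_le (hC i j))
    refine ⟨j, fun _ => ⟨hj', le_antisymm (hC i j) ?_, hj⟩⟩
    rw [hj', hi] at hle
    exact le_of_mul_le_mul_right (by rwa [one_mul]) hpos
  choose f hf using hstep
  obtain ⟨g, T, hTS, ⟨t, ht⟩, hgT, hg⟩ := exists_perm_of_mapsTo f
    (Finset.univ.filter fun i => x i = x i₀) ⟨i₀, by simp⟩
    (fun i hi => by simpa using (hf i (by simpa using hi)).1)
  have hT : ∀ i ∈ T, x i = x i₀ := fun i hi => by simpa using hTS hi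
  refine ⟨g, s, ?_, fun i => ?_, fun i hi => ?_⟩
  · rintro rfl
    have h1 := (hf t (hT t ht)).2.2
    rw [← (hgT t ht).1] at h1
    exact h1 rfl
  · by_cases hi : i ∈ T
    · rw [(hgT i hi).1]; exact (hf i (hT i hi)).2.1
    · rw [hg i hi, hd]
  · by_cases hi' : i ∈ T
    · rw [(hgT i hi').1]; exact (hf i (hT i hi')).2.2
    · exact absurd (hg i hi') hi

/-- Greedy extension of a partial solution supported on the nonzero coordinates of `x`, all of
which are at least `w`, to a full dependence. -/
lemma colorSingular_of_partial [Nontrivial X] {C : Matrix V V K} (hC : ∀ i j, C i j ≤ 1)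
    (hd : ∀ i, C i i = 1) (x : V → K) (hx : x ≠ 0) (s : V → X) (w : K)
    (hw : ∀ i, x i ≠ 0 → w ≤ x i ∧ (∀ j, C i j * x j ≤ x i) ∧
      ∃ j, s j ≠ s i ∧ C i j * x j = x i)
    (hw' : ∀ i, x i = 0 → ∀ j, C i j * x j ≤ w) : C.ColorSingular X := by
  classical
  induction hn : (Finset.univ.filter fun i => x i = 0).card using Nat.strong_induction_on
    generalizing x s w with
  | _ n ih =>
  by_cases hfin : ∀ i, x i = 0 → ∀ j, C i j * x j = 0
  · refine ⟨x, hx, s, fun i => ?_⟩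
    by_cases hi : x i = 0
    · exact Or.inl (hfin i hi)
    · obtain ⟨-, hle, j, hj, he⟩ := hw i hi
      exact Or.inr ⟨j, i, hj, by rw [he, hd, one_mul], fun l => he ▸ hle l⟩
  · push Not at hfin
    obtain ⟨i₁, hi₁, j₁, hj₁⟩ := hfin
    obtain ⟨⟨i, j⟩, hij, hmax⟩ := Finset.exists_max_image
      (Finset.univ.filter fun p : V × V => x p.1 = 0) (fun p => C p.1 p.2 * x p.2)
      ⟨(i₁, j₁), by simpa using hi₁⟩
    simp only [Finset.mem_filter, Finset.mem_univ, true_and, Prod.forall] at hij hmax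
    set m := C i j * x j with hm
    have hm0 : 0 < m := (pos_iff_ne_zero.2 hj₁).trans_le (hmax i₁ j₁ hi₁)
    have hmw : m ≤ w := hw' i hij j
    have hxj : x j ≠ 0 := by rintro h; simp [hm, h] at hm0
    have hji : j ≠ i := by rintro rfl; exact hxj hij
    obtain ⟨c, hc⟩ := exists_ne (s j)
    have hle : ∀ k, C k i * m ≤ m := fun k => mul_le_of_le_one_left zero_le (hC k i)
    refine ih _ ?_ (Function.update x i m) ?_ (Function.update s i c) m ?_ ?_ rfl
    · rw [← hn]
      refine Finset.card_lt_card (Finset.ssubset_iff_of_subset ?_ |>.2 ⟨i, by simpa using hij, ?_⟩)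
      · intro k
        by_cases hk : k = i <;> simp [hk, hm0.ne']
      · simp [hm0.ne']
    · exact Function.ne_iff.2 ⟨i, by simpa using hm0.ne'⟩
    · intro k hk
      by_cases hki : k = i
      · subst hki
        refine ⟨by simp, fun l => ?_, j, ?_, ?_⟩
        · by_cases hl : l = k
          · subst hl; simpa using hle l
          · simpa [hl] using hmax k l hij
        · simpa [hji] using hc.symm
        · simp [hji, hm]
      · simp only [Function.update_of_ne hki] at hk ⊢
        obtain ⟨h1, h2, l, hl, he⟩ := hw k hk
        have hli : l ≠ i := by
          rintro rfl
          rw [hij, mul_zero] at he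
          exact hk he.symm
        refine ⟨hmw.trans h1, fun l => ?_, l, by simpa [hli] using hl, by simpa [hli] using he⟩
        by_cases hl : l = i
        · subst hl; simpa using (hle k).trans (hmw.trans h1)
        · simpa [hl] using h2 l
    · intro k hk l
      have hki : k ≠ i := by rintro rfl; simp [hm0.ne'] at hk
      rw [Function.update_of_ne hki] at hk
      by_cases hl : l = i
      · subst hl; simpa using hle k
      · simpa [hl] using hmax k l hk

lemma colorSingular_of_perm [Nontrivial X] {C : Matrix V V K} (hC : ∀ i j, C i j ≤ 1)
    (hd : ∀ i, C i i = 1) (g : Equiv.Perm V) (s : V → X) (hg : g ≠ 1)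
    (hg1 : ∀ i, C i (g i) = 1) (hs : ∀ i, g i ≠ i → s (g i) ≠ s i) : C.ColorSingular X := by
  classical
  obtain ⟨i₀, hi₀⟩ := Equiv.ext_iff.not.1 hg |> not_forall.1
  have hle : ∀ i j, C i j * (if g j = j then 0 else 1) ≤ 1 := by
    intro i j
    split_ifs
    · simp
    · simpa using hC i j
  refine colorSingular_of_partial hC hd (fun i => if g i = i then 0 else 1) ?_ s 1 ?_ ?_
  · exact Function.ne_iff.2 ⟨i₀, by simpa using hi₀⟩
  · intro i hi
    have hi' : g i ≠ i := by simpa using hi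
    refine ⟨by simp [hi'], fun j => by simpa [hi'] using hle i j, g i, hs i hi', ?_⟩
    simp [hi', hg1]
  · exact fun i _ j => hle i j

/-- A matrix with unit diagonal, none of whose permutation products exceeds `1`, can be scaled
to have all entries at most `1`. -/
lemma exists_potential_s14 [DecidableEq V] {B : Matrix V V K} (hd : ∀ i, B i i = 1)
    (hB : ∀ σ : Equiv.Perm V, ∏ i, B i (σ i) ≤ 1) :
    ∃ u : V → K, (∀ i, u i ≠ 0) ∧ ∀ i j, B i j * u j ≤ u i := by
  classical
  let y : ℕ → V → K := fun k =>
    Nat.rec (motive := fun _ => V → K) (fun _ => 1) (fun _ z i => ∑ j, B i j * z j) k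
  have hy0 : ∀ i, y 0 i = 1 := fun _ => rfl
  have hle : ∀ k i j, B i j * y k j ≤ y (k + 1) i := fun k i j =>
    IsMaxAdd.le_sum (fun j => B i j * y k j) j
  have hex : ∀ k i, ∃ j, y (k + 1) i = B i j * y k j := fun k i => by
    obtain ⟨j, -, hj⟩ := IsMaxAdd.exists_eq_sum (fun j => B i j * y k j) Finset.univ
      ⟨i, Finset.mem_univ i⟩
    exact ⟨j, hj⟩
  have hmono : ∀ i, Monotone fun k => y k i := fun i => monotone_nat_of_le_succ fun k => by
    simpa [hd] using hle k i i
  have hpos : ∀ k i, 0 < y k i := fun k i =>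
    zero_lt_one.trans_le ((hy0 i).symm.trans_le (hmono i (Nat.zero_le k)))
  set N := Fintype.card V with hN
  have hstab : ∀ i, ∃ k, y k i = y N i := fun i => ⟨N, rfl⟩
  let t : V → ℕ := fun i => Nat.find (hstab i)
  have ht : ∀ i, y (t i) i = y N i := fun i => Nat.find_spec (hstab i)
  have htmin : ∀ i k, y k i = y N i → t i ≤ k := fun i k h => Nat.find_min' (hstab i) h
  have htN : ∀ i, t i ≤ N := fun i => htmin i N rfl
  have hstable : ∀ i k, t i ≤ k → k ≤ N → y k i = y N i := fun i k h1 h2 =>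
    le_antisymm (hmono i h2) ((ht i).symm.trans_le (hmono i h1))
  suffices hlt : ∀ i, t i < N by
    refine ⟨y N, fun i => (hpos N i).ne', fun i j => ?_⟩
    have hj := hlt j
    rw [← hstable j (N - 1) (by omega) (by omega)]
    refine (hle (N - 1) i j).trans_eq ?_
    rw [Nat.sub_add_cancel (by omega)]
  by_contra! hcon
  obtain ⟨v, hv⟩ := hcon
  replace hv : t v = N := le_antisymm (htN v) hv
  -- by pigeonhole some time is never a stabilisation time
  obtain ⟨m, hm, hmt⟩ : ∃ m ∈ Finset.range (N + 1), m ∉ Finset.univ.image t := by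
    apply Finset.exists_mem_notMem_of_card_lt_card
    rw [Finset.card_range]
    exact Finset.card_image_le.trans_lt (by rw [Finset.card_univ]; omega)
  replace hmt : ∀ i, t i ≠ m := by simpa using hmt
  have hmN : m < N := by
    have := hmt v
    have := Finset.mem_range.1 hm
    omega
  have hstep : ∀ i, ∃ j, 1 ≤ t i → y (t i) i = B i j * y (t i - 1) j := by
    intro i
    obtain ⟨j, hj⟩ := hex (t i - 1) i
    exact ⟨j, fun h => by rwa [Nat.sub_add_cancel h] at hj⟩
  choose f hf using hstep
  have htf : ∀ i, 1 ≤ t i → t i - 1 ≤ t (f i) := by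
    intro i hi
    by_contra! hlt
    have h1 : y (t i - 2) (f i) = y (t i - 1) (f i) := by
      rw [hstable _ (t i - 2) (by omega) (by have := htN i; omega),
        hstable _ (t i - 1) (by omega) (by have := htN i; omega)]
    have h2 := hle (t i - 2) i (f i)
    rw [h1, ← hf i hi, show t i - 2 + 1 = t i - 1 by omega, ht] at h2
    have := htmin i (t i - 1) (le_antisymm (hmono i (by have := htN i; omega)) h2)
    omega
  obtain ⟨g, T, hTS, hTne, hgT, hg⟩ := exists_perm_of_mapsTo f
    (Finset.univ.filter fun i => m < t i) ⟨v, by simpa [hv] using hmN⟩ (fun i hi => by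
      simp only [Finset.mem_filter, Finset.mem_univ, true_and] at hi ⊢
      have := htf i (by omega)
      have := hmt (f i)
      omega)
  have hT : ∀ i ∈ T, 1 ≤ t i := fun i hi => by
    have : m < t i := by simpa using hTS hi
    omega
  have hge : ∀ i ∈ T, y N i ≤ B i (f i) * y N (f i) := fun i hi => by
    rw [← ht i, hf i (hT i hi)]
    exact mul_le_mul_of_nonneg_left (hmono _ (by have := htN i; omega)) zero_le
  obtain ⟨i, hi, hmin⟩ := Finset.exists_min_image T t hTne
  have hstrict : y N i < B i (f i) * y N (f i) := by
    have h1 : y (t i - 1) (f i) < y N (f i) := by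
      refine lt_of_le_of_ne (hmono _ (by have := htN i; omega)) fun h => ?_
      have h2 := htmin _ _ h
      have h3 := hmin _ (hgT i hi).2
      have := hT i hi
      omega
    have h2 : B i (f i) ≠ 0 := by
      intro h
      have := hf i (hT i hi)
      rw [h, zero_mul] at this
      exact (hpos _ _).ne' this
    rw [← ht i, hf i (hT i hi)]
    exact mul_lt_mul_of_pos_left h1 (pos_iff_ne_zero.2 h2)
  have hprod : ∏ i, y N i < ∏ i, B i (g i) * y N (g i) := by
    refine Finset.prod_lt_prod (fun i _ => hpos N i) (fun j _ => ?_)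
      ⟨i, Finset.mem_univ i, by rwa [(hgT i hi).1]⟩
    by_cases hj : j ∈ T
    · rw [(hgT j hj).1]; exact hge j hj
    · rw [hg j hj, hd, one_mul]
  rw [Finset.prod_mul_distrib, Equiv.prod_comp g (y N)] at hprod
  exact hprod.not_ge (mul_le_of_le_one_left zero_le (hB g))

/-- Hungarian normal form: if some permutation product is nonzero, then up to scaling and a
permutation of the columns all entries are at most `1` and the diagonal is `1`. -/
lemma exists_hungarian [DecidableEq V] {A : Matrix V V K}
    (hA : ∃ σ : Equiv.Perm V, ∀ i, A i (σ i) ≠ 0) :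
    ∃ (π : Equiv.Perm V) (u v : V → K), (∀ i, u i ≠ 0) ∧ (∀ j, v j ≠ 0) ∧
      (∀ i j, u i * A i (π j) * v j ≤ 1) ∧ ∀ i, u i * A i (π i) * v i = 1 := by
  obtain ⟨π, -, hπ⟩ := Finset.exists_max_image Finset.univ
    (fun σ : Equiv.Perm V => ∏ i, A i (σ i)) ⟨1, Finset.mem_univ _⟩
  have hpos : 0 < ∏ i, A i (π i) := by
    obtain ⟨σ, hσ⟩ := hA
    exact (pos_iff_ne_zero.2 (Finset.prod_ne_zero_iff.2 fun i _ => hσ i)).trans_le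
      (hπ σ (Finset.mem_univ _))
  have hne : ∀ i, A i (π i) ≠ 0 := fun i =>
    Finset.prod_ne_zero_iff.1 hpos.ne' i (Finset.mem_univ _)
  obtain ⟨u, hu, hle⟩ := exists_potential_s14 (B := fun i j => A i (π j) * (A j (π j))⁻¹)
    (fun i => mul_inv_cancel₀ (hne i)) (fun σ => by
      rw [Finset.prod_mul_distrib, Finset.prod_inv_distrib,
        Equiv.prod_comp σ (fun j => A j (π j)), ← div_eq_mul_inv, div_le_one₀ hpos]
      exact hπ (σ.trans π) (Finset.mem_univ _))
  refine ⟨π, fun i => (u i)⁻¹, fun j => (A j (π j))⁻¹ * u j, fun i => inv_ne_zero (hu i),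
    fun j => mul_ne_zero (inv_ne_zero (hne j)) (hu j), fun i j => ?_, fun i => ?_⟩
  · have h := hle i j
    rw [show (u i)⁻¹ * A i (π j) * ((A j (π j))⁻¹ * u j)
      = (A i (π j) * (A j (π j))⁻¹ * u j) / u i by rw [div_eq_mul_inv]; ring]
    exact (div_le_one₀ (pos_iff_ne_zero.2 (hu i))).2 h
  · have := hu i
    have := hne i
    field_simp

/-- A square matrix with a repeated row and a nonzero permutation product is dependent. -/
lemma colorSingular_of_row_eq [Nontrivial X] [DecidableEq V] {A : Matrix V V K}
    (hA : ∃ σ : Equiv.Perm V, ∀ i, A i (σ i) ≠ 0) {i₀ i₁ : V} (hi : i₀ ≠ i₁)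
    (hrow : ∀ j, A i₀ j = A i₁ j) : A.ColorSingular X := by
  obtain ⟨π, u, v, hu, hv, hle, hd⟩ := exists_hungarian hA
  refine ColorSingular.of_scaled (B := fun i j => u i * A i (π j) * v j) (Equiv.refl V) π hu hv
    (fun _ _ => rfl) ?_
  have huu : u i₀ = u i₁ := by
    have aux : ∀ a b, (∀ j, A a j = A b j) → u a ≤ u b := by
      intro a b h
      have h1 := hle a b
      rw [h] at h1
      have h2 := (hd b).ge.trans' h1
      rw [mul_assoc, mul_assoc] at h2
      have hp : A b (π b) * v b ≠ 0 := by
        intro h0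
        have := hd b
        rw [mul_assoc, h0, mul_zero] at this
        exact zero_ne_one this
      exact le_of_mul_le_mul_right h2 (pos_iff_ne_zero.2 hp)
    exact le_antisymm (aux _ _ hrow) (aux _ _ fun j => (hrow j).symm)
  obtain ⟨a, b, hab⟩ := exists_pair_ne X
  refine colorSingular_of_perm hle hd (Equiv.swap i₀ i₁) (fun i => if i = i₀ then a else b)
    (fun h => hi (Equiv.swap_eq_one_iff.1 h)) (fun i => ?_) fun i h => ?_
  · by_cases h0 : i = i₀
    · subst h0
      rw [Equiv.swap_apply_left, huu, hrow, hd]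
    by_cases h1 : i = i₁
    · subst h1
      rw [Equiv.swap_apply_right, ← huu, ← hrow, hd]
    · rw [Equiv.swap_apply_of_ne_of_ne h0 h1, hd]
  · by_cases h0 : i = i₀
    · subst h0
      simpa [hi.symm] using hab.symm
    by_cases h1 : i = i₁
    · subst h1
      simpa [h0] using hab
    · exact absurd (Equiv.swap_apply_of_ne_of_ne h0 h1) h

lemma colorSingular_of_forall_perm [Nontrivial X] [DecidableEq V] {A : Matrix V V K}
    (hA : ∀ σ : Equiv.Perm V, ∃ i, A i (σ i) = 0) : A.ColorSingular X := by
  classical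
  let N : V → Finset V := fun j => Finset.univ.filter fun i => A i j ≠ 0
  have hN : ∀ i j, i ∈ N j ↔ A i j ≠ 0 := fun i j => by simp [N]
  have hHall : ∃ J : Finset V, (J.biUnion N).card < J.card := by
    by_contra! h
    obtain ⟨φ, hφ, hφN⟩ := (Finset.all_card_le_biUnion_card_iff_exists_injective N).1 h
    let e := Equiv.ofBijective φ ⟨hφ, Finite.injective_iff_surjective.1 hφ⟩
    obtain ⟨i, hi⟩ := hA e.symm
    have := (hN _ _).1 (hφN (e.symm i))
    rw [show φ (e.symm i) = i from e.apply_symm_apply i] at this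
    exact this hi
  obtain ⟨J, hJ, hmin⟩ := Finset.exists_min_image
    (Finset.univ.filter fun J : Finset V => (J.biUnion N).card < J.card) Finset.card
    (by obtain ⟨J, hJ⟩ := hHall; exact ⟨J, by simpa using hJ⟩)
  simp only [Finset.mem_filter, Finset.mem_univ, true_and] at hJ hmin
  obtain ⟨j₀, hj₀⟩ : J.Nonempty := Finset.card_pos.1 (by omega)
  obtain ⟨c⟩ : Nonempty X := inferInstance
  by_cases hcol : ∀ i, A i j₀ = 0
  · refine ⟨Pi.single j₀ 1, by simp, fun _ => c, fun i => Or.inl fun j => ?_⟩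
    by_cases h : j = j₀
    · subst h; simp [hcol]
    · simp [h]
  push Not at hcol
  obtain ⟨i₁, hi₁⟩ := hcol
  obtain ⟨φ, hφ, hφN⟩ := (Finset.all_card_le_biUnion_card_iff_exists_injective
    (fun j : {j // j ∈ J.erase j₀} => N j.1)).1 (by
      intro s
      by_contra! h
      have h1 := hmin (s.map (Function.Embedding.subtype _)) (by
        rw [Finset.card_map]
        rwa [Finset.map_eq_image, Finset.image_biUnion])
      have h2 : s.card ≤ (J.erase j₀).card := by
        simpa only [Fintype.card_coe] using Finset.card_le_univ s
      rw [Finset.card_map] at h1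
      rw [Finset.card_erase_of_mem hj₀] at h2
      omega)
  have hrange : Finset.univ.image φ = J.biUnion N := by
    refine Finset.eq_of_subset_of_card_le ?_ ?_
    · intro i hi
      obtain ⟨j, -, rfl⟩ := Finset.mem_image.1 hi
      exact Finset.mem_biUnion.2 ⟨j, Finset.mem_of_mem_erase j.2, hφN j⟩
    · rw [Finset.card_image_of_injective _ hφ, Finset.card_univ, Fintype.card_coe,
        Finset.card_erase_of_mem hj₀]
      omega
  have hcover : ∀ i j, j ∈ J → A i j ≠ 0 → ∃ k, φ k = i := by
    intro i j hj hij
    have : i ∈ Finset.univ.image φ := by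
      rw [hrange]; exact Finset.mem_biUnion.2 ⟨j, hj, (hN _ _).2 hij⟩
    simpa using this
  -- the rows matched to the columns in `J`, with one row repeated
  let row : {j // j ∈ J} → V := fun j =>
    if h : j.1 = j₀ then i₁ else φ ⟨j.1, Finset.mem_erase.2 ⟨h, j.2⟩⟩
  have hrow₀ : row ⟨j₀, hj₀⟩ = i₁ := by simp [row]
  have hrowφ : ∀ k : {j // j ∈ J.erase j₀}, row ⟨k.1, Finset.mem_of_mem_erase k.2⟩ = φ k :=
    fun k => by simp [row, Finset.ne_of_mem_erase k.2]
  obtain ⟨j₁, hj₁⟩ := hcover i₁ j₀ hj₀ hi₁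
  have hM : (A.submatrix row (Subtype.val : {j // j ∈ J} → V)).ColorSingular X := by
    refine colorSingular_of_row_eq (i₀ := ⟨j₀, hj₀⟩)
      (i₁ := ⟨j₁.1, Finset.mem_of_mem_erase j₁.2⟩) ⟨1, fun j => ?_⟩ ?_ fun j => ?_
    · by_cases h : j.1 = j₀
      · obtain rfl : j = ⟨j₀, hj₀⟩ := Subtype.ext h
        simpa [hrow₀] using hi₁
      · have := (hN _ _).1 (hφN ⟨j.1, Finset.mem_erase.2 ⟨h, j.2⟩⟩)
        simpa [row, h] using this
    · intro h
      exact Finset.ne_of_mem_erase j₁.2 (Subtype.ext_iff.1 h).symm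
    · rw [submatrix_apply, submatrix_apply, hrow₀, hrowφ, hj₁]
  obtain ⟨x, hx, s, hs⟩ := hM
  let x' : V → K := fun j => if h : j ∈ J then x ⟨j, h⟩ else 0
  have hx'J : ∀ j : {j // j ∈ J}, x' j.1 = x j := fun j => by simp [x']
  have hx'0 : ∀ j ∉ J, x' j = 0 := fun j h => by simp [x', h]
  refine ⟨x', ?_, fun j => if h : j ∈ J then s ⟨j, h⟩ else c, fun i => ?_⟩
  · obtain ⟨j, hj⟩ := Function.ne_iff.1 hx
    exact Function.ne_iff.2 ⟨j.1, by rwa [hx'J]⟩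
  by_cases hi : ∃ r, row r = i
  · obtain ⟨r, rfl⟩ := hi
    rcases hs r with h0 | ⟨j, k, hjk, he, hle⟩
    · left
      intro j
      by_cases hj : j ∈ J
      · simpa [hx'J ⟨j, hj⟩] using h0 ⟨j, hj⟩
      · rw [hx'0 j hj, mul_zero]
    · right
      refine ⟨j, k, by simpa using hjk, by simpa only [submatrix_apply, hx'J] using he, fun l => ?_⟩
      by_cases hl : l ∈ J
      · have := hle ⟨l, hl⟩
        rwa [submatrix_apply, submatrix_apply, ← hx'J, ← hx'J] at this
      · rw [hx'0 l hl, mul_zero]; exact zero_le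
  · left
    intro j
    by_cases hj : j ∈ J
    · have : A i j = 0 := by
        by_contra h
        obtain ⟨k, hk⟩ := hcover i j hj h
        exact hi ⟨_, (hrowφ k).trans hk⟩
      rw [this, zero_mul]
    · rw [hx'0 j hj, mul_zero]

theorem ColorSingular.transpose [Nontrivial X] {A : Matrix V V K}
    (hA : A.ColorSingular X) : Aᵀ.ColorSingular X := by
  classical
  by_cases hp : ∃ σ : Equiv.Perm V, ∀ i, A i (σ i) ≠ 0
  · obtain ⟨π, u, v, hu, hv, hle, hd⟩ := exists_hungarian hp
    have hC := hA.scaled (B := fun i j => u i * A i (π j) * v j) (Equiv.refl V) π hu hv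
      fun _ _ => rfl
    obtain ⟨g, s, hg, hg1, hs⟩ := hC.exists_perm hle hd
    refine ColorSingular.of_scaled (B := fun j i => u i * A i (π j) * v j) π (Equiv.refl V) hv hu
      (fun j i => by simp only [transpose_apply, Equiv.refl_apply]; ring) ?_
    refine colorSingular_of_perm (fun i j => hle j i) hd g⁻¹ s (inv_ne_one.2 hg)
      (fun i => ?_) fun i hi => ?_
    · have := hg1 (g⁻¹ i)
      rwa [show g (g⁻¹ i) = i from g.apply_symm_apply i] at this
    · have := hs (g⁻¹ i)
      rw [show g (g⁻¹ i) = i from g.apply_symm_apply i] at this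
      exact (this hi.symm).symm
  · push Not at hp
    refine colorSingular_of_forall_perm fun σ => ?_
    obtain ⟨i, hi⟩ := hp σ⁻¹
    exact ⟨σ⁻¹ i, by simpa using hi⟩

lemma tropStarSingular_iff_colorSingular {I : Type*} (A : Matrix I V K) :
    A.TropStarSingular ↔ A.ColorSingular Bool := by
  classical
  constructor
  · rintro ⟨x₁, x₂, hdisj, hne, he⟩
    refine ⟨x₁ + x₂, hne, fun j => decide (x₁ j ≠ 0), fun i => ?_⟩
    have hi : ∑ l, A i l * x₁ l = ∑ l, A i l * x₂ l := congrFun he i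
    refine (IsMaxAdd.sum_eq_sum_iff.1 hi).imp ?_ ?_
    · intro h j
      rw [Pi.add_apply, mul_add, h]
    · rintro ⟨j, k, hj, hjk, hle⟩
      have hj₁ : x₁ j ≠ 0 := right_ne_zero_of_mul hj
      have hk₂ : x₂ k ≠ 0 := right_ne_zero_of_mul (hjk ▸ hj)
      have hj₂ : x₂ j = 0 := (hdisj j).resolve_left hj₁
      have hk₁ : x₁ k = 0 := (hdisj k).resolve_right hk₂
      refine ⟨j, k, by simp [hj₁, hk₁], by simpa [hj₂, hk₁] using hjk, fun l => ?_⟩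
      simpa [hj₂, mul_add] using hle l
  · rintro ⟨x, hx, s, hs⟩
    have hsum : ∀ l, (if s l then x l else 0) + (if s l then 0 else x l) = x l := fun l => by
      split_ifs <;> simp
    refine ⟨fun j => if s j then x j else 0, fun j => if s j then 0 else x j,
      fun k => by by_cases h : s k <;> simp [h], ?_, ?_⟩
    · intro h
      exact hx (funext fun l => (hsum l).symm.trans (congrFun h l))
    · funext i
      refine IsMaxAdd.sum_eq_sum_iff.2 ?_
      simp only [← mul_add, hsum]
      rcases hs i with h0 | ⟨j, k, hjk, he, hle⟩
      · exact Or.inl h0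
      by_cases hz : A i j * x j = 0
      · left
        intro l
        have := hle l
        rw [hz] at this
        exact nonpos_iff_eq_zero.1 this
      right
      by_cases hj : s j
      · have hk : s k = false := by simpa [hj] using hjk.symm
        refine ⟨j, k, ?_⟩
        simp only [hj, hk, if_true, Bool.false_eq_true, if_false]
        exact ⟨hz, he, hle⟩
      · have hk : s k = true := by simpa [hj] using hjk.symm
        refine ⟨k, j, ?_⟩
        simp only [hj, hk, if_true, Bool.false_eq_true, if_false]
        exact ⟨he ▸ hz, he.symm, fun l => he ▸ hle l⟩

lemma tropSingular_iff_colorSingular {I : Type*} {n : ℕ} (A : Matrix I (Fin n) K) :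
    A.TropSingular ↔ A.ColorSingular ℕ := by
  classical
  constructor
  · rintro ⟨A₁, A₂, rfl, hdisj, x, hx, he⟩
    refine ⟨x, hx, Fin.val, fun i => ?_⟩
    have hi : ∑ l, A₁ i l * x l = ∑ l, A₂ i l * x l := congrFun he i
    refine (IsMaxAdd.sum_eq_sum_iff.1 hi).imp ?_ ?_
    · intro h j
      rw [add_apply, add_mul, h]
    · rintro ⟨j, k, hj, hjk, hle⟩
      have hj₁ : A₁ i j ≠ 0 := left_ne_zero_of_mul hj
      have hk₂ : A₂ i k ≠ 0 := left_ne_zero_of_mul (hjk ▸ hj)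
      have hj₂ : A₂ i j = 0 := (hdisj i j).resolve_left hj₁
      have hk₁ : A₁ i k = 0 := (hdisj i k).resolve_right hk₂
      refine ⟨j, k, ?_, by simpa [hj₂, hk₁] using hjk, fun l => ?_⟩
      · intro h
        rw [Fin.ext h] at hj₁
        exact hj₁ hk₁
      · simpa [hj₂, add_mul] using hle l
  · rintro ⟨x, hx, s, hs⟩
    obtain ⟨j₀, -⟩ := Function.ne_iff.1 hx
    have hrow : ∀ i, ∃ j, (∀ l, A i l * x l = 0) ∨
        ∃ k, k ≠ j ∧ A i j * x j = A i k * x k ∧ ∀ l, A i l * x l ≤ A i j * x j := by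
      intro i
      rcases hs i with h0 | ⟨j, k, hjk, h⟩
      · exact ⟨j₀, Or.inl h0⟩
      · exact ⟨j, Or.inr ⟨k, fun e => hjk (e ▸ rfl), h⟩⟩
    choose c hc using hrow
    have hsum : ∀ i l, (if l = c i then A i l else 0) + (if l = c i then 0 else A i l) = A i l :=
      fun i l => by split_ifs <;> simp
    refine ⟨of fun i l => if l = c i then A i l else 0, of fun i l => if l = c i then 0 else A i l,
      ?_, fun i l => by by_cases h : l = c i <;> simp [h], x, hx, ?_⟩
    · ext i l
      exact (hsum i l).symm
    · funext i
      change ∑ l, (if l = c i then A i l else 0) * x l = ∑ l, (if l = c i then 0 else A i l) * x l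
      refine IsMaxAdd.sum_eq_sum_iff.2 ?_
      simp only [← add_mul, hsum]
      rcases hc i with h0 | ⟨k, hk, he, hle⟩
      · exact Or.inl h0
      by_cases hz : A i (c i) * x (c i) = 0
      · left
        intro l
        have := hle l
        rw [hz] at this
        exact nonpos_iff_eq_zero.1 this
      · refine Or.inr ⟨c i, k, ?_⟩
        simp only [if_true, hk, if_false]
        exact ⟨hz, he, hle⟩

end Matrix

theorem regular_iff_transpose_regular {K : Type*} [Semifield K] [LinearOrder K]
    (hadd : ∀ a b : K, a + b = max a b) {n : ℕ} (A : Matrix (Fin n) (Fin n) K) :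
    (¬ A.TropSingular ↔ ¬ A.transpose.TropSingular) ∧
    (¬ A.TropStarSingular ↔ ¬ A.transpose.TropStarSingular) := by
  have : IsMaxAdd K := ⟨hadd⟩
  simp only [Matrix.tropSingular_iff_colorSingular, Matrix.tropStarSingular_iff_colorSingular]
  exact ⟨not_congr ⟨fun h => h.transpose, fun h => h.transpose⟩,
    not_congr ⟨fun h => h.transpose, fun h => h.transpose⟩⟩
end
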